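/- Let k ≥ 4 and let w be a word over Σ = {a,b}. Let p and q be two consecutive occurrences of u in w, with p occurring before q, and let F_p, F_q be their sets of forbidden positions. If F_q = {0} ∪ {i, i+1, …, k−1} for some 1 ≤ i ≤ k−1 and |F_p| = |F_q|, then F_p = F_q. -/

import Mathlib

namespace Restivo

/-- Words over the two-letter alphabet Σ = {a, b}, encoded as lists of booleans. -/
abbrev Word := List Bool

/-- The letter `a`. -/
def a : Bool := false

/-- The letter `b`. -/
def b : Bool := true

/-- Kleene star: all finite concatenations of words from `S` (including the empty word). -/
def kstar (S : Set Word) : Set Word :=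
  { w | ∃ L : List Word, (∀ x ∈ L, x ∈ S) ∧ L.flatten = w }

/-- Prefixes of words of `L`. -/
def Pref (L : Set Word) : Set Word := { w | ∃ z : Word, w ++ z ∈ L }

/-- Factors (contiguous subwords) of words of `L`. -/
def Facts (L : Set Word) : Set Word := { w | ∃ x y : Word, x ++ w ++ y ∈ L }

/-- The word u = b a^(k-1). -/
def u (k : ℕ) : Word := b :: List.replicate (k - 1) a

/-- The word v = b^(k-1) a. -/
def v (k : ℕ) : Word := List.replicate (k - 1) b ++ [a]

/-- The set S_k = (Σ^k \ {u, v}) ∪ (Σ^(k-1) \ {a^(k-1), b^(k-1)}). -/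
def Sk (k : ℕ) : Set Word :=
  { w | w.length = k ∧ w ≠ u k ∧ w ≠ v k } ∪
  { w | w.length = k - 1 ∧ w ≠ List.replicate (k - 1) a ∧ w ≠ List.replicate (k - 1) b }

/-- Position `j` is forbidden in `w` w.r.t. `S` if the suffix of `w` starting from
position `j` is not a prefix of any word of `S*`. -/
def Forbidden (S : Set Word) (w : Word) (j : ℕ) : Prop :=
  w.drop j ∉ Pref (kstar S)

/-- The word `p` occurs in `w` at position `s`. -/
def OccursAt (p w : Word) (s : ℕ) : Prop :=
  s + p.length ≤ w.length ∧ (w.drop s).take p.length = p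

/-- The set of (locally enumerated) forbidden positions of the occurrence of `p`
at position `s` in `w`, with respect to `S_k`. -/
def Focc (k : ℕ) (w p : Word) (s : ℕ) : Set ℕ :=
  { i | i < p.length ∧ Forbidden (Sk k) w (s + i) }

/-- Two occurrences (of words from {u, v}) at positions `s < t` in `w` are
consecutive: no word from {u, v} occurs at a position strictly between them. -/
def Consecutive (k : ℕ) (w : Word) (s t : ℕ) : Prop :=
  s < t ∧ ∀ m, s < m → m < t → ¬ OccursAt (u k) w m ∧ ¬ OccursAt (v k) w m

/-- `w` is a minimal uncompletable word for `S`. -/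
def MinUncompletable (S : Set Word) (w : Word) : Prop :=
  w ∉ Facts (kstar S) ∧ ∀ w' : Word, w' ∉ Facts (kstar S) → w.length ≤ w'.length

lemma length_u {k : ℕ} (hk : 1 ≤ k) : (u k).length = k := by
  simp [u]; omega

lemma length_v {k : ℕ} (hk : 1 ≤ k) : (v k).length = k := by
  simp [v]; omega

/-- If a factor of `w` at position `j` lies in `S` and the position just after it is not
forbidden, then `j` is not forbidden. -/
lemma not_forbidden_of_take_mem {S : Set Word} {w : Word} {j n : ℕ}
    (hS : (w.drop j).take n ∈ S) (hf : ¬ Forbidden S w (j + n)) : ¬ Forbidden S w j := by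
  simp only [Forbidden, not_not] at hf ⊢
  obtain ⟨z, L, hL, hz⟩ := hf
  refine ⟨z, (w.drop j).take n :: L, ?_, ?_⟩
  · simpa using ⟨hS, hL⟩
  · rw [List.flatten_cons, hz, ← List.append_assoc, ← List.drop_drop, List.take_append_drop]

lemma Forbidden.add_of_not_occursAt {k : ℕ} (hk : 1 ≤ k) {w : Word} {j : ℕ}
    (hj : j + k ≤ w.length) (hu : ¬ OccursAt (u k) w j) (hv : ¬ OccursAt (v k) w j)
    (hf : Forbidden (Sk k) w j) : Forbidden (Sk k) w (j + k) := by
  by_contra hn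
  refine not_forbidden_of_take_mem (Or.inl ⟨?_, ?_, ?_⟩) hn hf
  · simp; omega
  · intro h
    exact hu ⟨by rwa [length_u hk], by rwa [length_u hk]⟩
  · intro h
    exact hv ⟨by rwa [length_v hk], by rwa [length_v hk]⟩

lemma OccursAt.getElem?_add {p w : Word} {s m : ℕ} (h : OccursAt p w s) (hm : m < p.length) :
    w[s + m]? = p[m]? := by
  conv_rhs => rw [← h.2]
  simp [hm]

lemma OccursAt.getElem?_u {k : ℕ} (hk : 1 ≤ k) {w : Word} {s : ℕ} (h : OccursAt (u k) w s) :
    w[s]? = some b := by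
  simpa [u] using h.getElem?_add (m := 0) (by rw [length_u hk]; omega)

lemma OccursAt.getElem?_u_add {k : ℕ} {w : Word} {s m : ℕ} (h : OccursAt (u k) w s)
    (hm : 1 ≤ m) (hmk : m < k) : w[s + m]? = some a := by
  rw [h.getElem?_add (by rw [length_u (by omega)]; omega)]
  obtain ⟨m, rfl⟩ := Nat.exists_eq_add_of_le' hm
  rw [u, List.getElem?_cons_succ, List.getElem?_replicate_of_lt (by omega)]

/-- Two distinct occurrences of `u k` do not overlap. -/
lemma OccursAt.add_le_of_lt {k : ℕ} (hk : 1 ≤ k) {w : Word} {s t : ℕ}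
    (hs : OccursAt (u k) w s) (ht : OccursAt (u k) w t) (hst : s < t) : s + k ≤ t := by
  by_contra! hlt
  have h := hs.getElem?_u_add (m := t - s) (by omega) (by omega)
  rw [show s + (t - s) = t by omega, ht.getElem?_u hk] at h
  simp [a, b] at h

/-- The first and the last positions of an occurrence of `u k` are forbidden together. -/
lemma Forbidden.add_of_occursAt_u {k : ℕ} (hk : 3 ≤ k) {w : Word} {s : ℕ}
    (hs : OccursAt (u k) w s) (hf : Forbidden (Sk k) w s) : Forbidden (Sk k) w (s + (k - 1)) := by
  have hlen := hs.1
  rw [length_u (by omega)] at hlen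
  have hb := hs.getElem?_u (by omega)
  have ha := hs.getElem?_u_add (m := 1) le_rfl (by omega)
  by_contra hn
  refine not_forbidden_of_take_mem (Or.inr ⟨?_, ?_, ?_⟩) hn hf
  · simp; omega
  · intro h
    have h0 := congrArg (fun l : Word => l[0]?) h
    simp [show 0 < k - 1 by omega, hb, a, b] at h0
  · intro h
    have h1 := congrArg (fun l : Word => l[1]?) h
    simp [show 1 < k - 1 by omega, ha, a, b] at h1

/-- A position `t + i` of an occurrence of `u k` at `t` with `t + i - 1` not forbidden has a
non-forbidden position `k` letters before it, provided that `v k` does not occur there. -/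
lemma not_forbidden_sub_of_occursAt_u {k : ℕ} {w : Word} {t i j : ℕ}
    (ht : OccursAt (u k) w t) (hi : 2 ≤ i) (hik : i < k) (hj : j + k = t + i)
    (hv : ¬ OccursAt (v k) w j) (hf : ¬ Forbidden (Sk k) w (t + (i - 1))) :
    ¬ Forbidden (Sk k) w j := by
  have hlen := ht.1
  rw [length_u (by omega)] at hlen
  have hb := ht.getElem?_u (by omega)
  have ha := ht.getElem?_u_add (m := i - 1) (by omega) (by omega)
  have hjt : j + (k - 1) = t + (i - 1) := by omega
  refine not_forbidden_of_take_mem (n := k - 1) (Or.inr ⟨?_, ?_, ?_⟩) (by rwa [hjt])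
  · simp; omega
  · intro h
    have h0 := congrArg (fun l : Word => l[k - i]?) h
    simp [show k - i < k - 1 by omega, show j + (k - i) = t by omega, hb, a, b] at h0
  · intro h
    refine hv ⟨by rw [length_v (by omega)]; omega, ?_⟩
    rw [length_v (by omega), show k = k - 1 + 1 by omega, List.take_add_one, h,
      List.getElem?_drop, hjt, ha]
    simp [v]

lemma Consecutive.forbidden_add_mul {k : ℕ} (hk : 1 ≤ k) {w : Word} {s t : ℕ}
    (hcons : Consecutive k w s t) (ht : OccursAt (u k) w t) {j : ℕ} (hj : s < j) (n : ℕ)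
    (hn : j + n * k < t + k) (hf : Forbidden (Sk k) w j) : Forbidden (Sk k) w (j + n * k) := by
  have hlen := ht.1
  rw [length_u hk] at hlen
  induction n with
  | zero => simpa using hf
  | succ n ih =>
    rw [add_mul, one_mul] at hn
    rw [add_mul, one_mul, ← add_assoc]
    obtain ⟨hu, hv⟩ := hcons.2 (j + n * k) (by omega) (by omega)
    exact (ih (by omega)).add_of_not_occursAt hk (by omega) hu hv

/-- A set of residues modulo `k` containing `0` only together with `k - 1`, whose nonzero part is
shifted by `c` into `{0} ∪ {i + 1, …, k - 1}` and which has `k - i + 1` elements, is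
`{0} ∪ {i, …, k - 1}`. -/
lemma eq_insert_Icc_of_shift {k i c : ℕ} (hi : 1 ≤ i) (hik : i < k) (hc : c < k) {F : Finset ℕ}
    (hF : ∀ x ∈ F, x < k) (h0 : 0 ∈ F → k - 1 ∈ F) (hcard : F.card = k - i + 1)
    (hshift : ∀ x ∈ F, x ≠ 0 → (x + c) % k = 0 ∨ i + 1 ≤ (x + c) % k) :
    F = insert 0 (Finset.Icc i (k - 1)) := by
  have hmod (x : ℕ) (hx : x < k) : x + c < k ∧ (x + c) % k = x + c ∨
      k ≤ x + c ∧ (x + c) % k = x + c - k := by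
    rcases lt_or_ge (x + c) k with h | h
    · exact Or.inl ⟨h, Nat.mod_eq_of_lt h⟩
    · exact Or.inr ⟨h, by rw [Nat.mod_eq_sub_mod h, Nat.mod_eq_of_lt (by omega)]⟩
  have hB : (insert 0 (Finset.Icc (i + 1) (k - 1))).card = k - i := by
    rw [Finset.card_insert_of_notMem (by simp), Nat.card_Icc]
    omega
  have hinj : Set.InjOn (fun x => (x + c) % k) (F.erase 0 : Finset ℕ) := by
    intro x hx y hy hxy
    simp only [Finset.coe_erase, Set.mem_sdiff, Finset.mem_coe] at hx hy hxy
    have := hmod x (hF x hx.1)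
    have := hmod y (hF y hy.1)
    have := hF x hx.1
    have := hF y hy.1
    omega
  have hsub : (F.erase 0).image (fun x => (x + c) % k) ⊆ insert 0 (Finset.Icc (i + 1) (k - 1)) := by
    intro y hy
    obtain ⟨x, hx, rfl⟩ := Finset.mem_image.1 hy
    rw [Finset.mem_erase] at hx
    have := hshift x hx.2 hx.1
    have := Nat.mod_lt (x + c) (by omega : 0 < k)
    simp only [Finset.mem_insert, Finset.mem_Icc]
    omega
  have hle := Finset.card_le_card hsub
  rw [Finset.card_image_of_injOn hinj, hB] at hle
  have h0F : 0 ∈ F := by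
    by_contra h
    rw [Finset.erase_eq_of_notMem h] at hle
    omega
  have himage := Finset.eq_of_subset_of_card_le hsub (by
    rw [Finset.card_image_of_injOn hinj, hB, Finset.card_erase_of_mem h0F]
    omega)
  have hsurj (y : ℕ) (hy : y = 0 ∨ i + 1 ≤ y ∧ y ≤ k - 1) : ∃ x ∈ F, x ≠ 0 ∧ (x + c) % k = y := by
    have : y ∈ (F.erase 0).image (fun x => (x + c) % k) := by
      rw [himage]
      simpa using hy
    obtain ⟨x, hx, hxy⟩ := Finset.mem_image.1 this
    rw [Finset.mem_erase] at hx
    exact ⟨x, hx.2, hx.1, hxy⟩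
  have hc0 : 1 ≤ c ∧ c ≤ i := by
    by_contra hcon
    obtain ⟨x, hx, hx0, hxc⟩ := hsurj c (by omega)
    have := hmod x (hF x hx)
    have := hF x hx
    omega
  have hc1 : c = 1 := by
    have := hshift (k - 1) (h0 h0F) (by omega)
    have := hmod (k - 1) (by omega)
    omega
  subst hc1
  refine Finset.eq_of_subset_of_card_le (fun x hx => ?_) ?_
  · have := hF x hx
    have := hmod x this
    have := hshift x hx
    simp only [Finset.mem_insert, Finset.mem_Icc]
    omega
  · rw [hcard, Finset.card_insert_of_notMem (by simp; omega), Nat.card_Icc]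
    omega

theorem statement14 (k : ℕ) (hk : 4 ≤ k) (w : Word)
    (s t : ℕ) (hop : OccursAt (u k) w s) (hoq : OccursAt (u k) w t)
    (hcons : Consecutive k w s t)
    (i : ℕ) (hi1 : 1 ≤ i) (hi2 : i ≤ k - 1)
    (hFq : Focc k w (u k) t = insert 0 (Set.Icc i (k - 1)))
    (hcard : (Focc k w (u k) s).ncard = (Focc k w (u k) t).ncard) :
    Focc k w (u k) s = Focc k w (u k) t := by
  have hmem (r x : ℕ) : x ∈ Focc k w (u k) r ↔ x < k ∧ Forbidden (Sk k) w (r + x) := by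
    simp [Focc, length_u (show 1 ≤ k by omega)]
  have hFt (x : ℕ) (hx : x < k) : Forbidden (Sk k) w (t + x) ↔ x = 0 ∨ i ≤ x := by
    have h := hmem t x
    rw [hFq, Set.mem_insert_iff, Set.mem_Icc] at h
    constructor
    · intro hf
      have := h.2 ⟨hx, hf⟩
      omega
    · exact fun hx' => (h.1 (by omega)).2
  have hfin : (Focc k w (u k) s).Finite :=
    (Set.finite_Iio k).subset fun x hx => ((hmem s x).1 hx).1
  have hcoe : (insert 0 (Set.Icc i (k - 1)) : Set ℕ) =
      ((insert 0 (Finset.Icc i (k - 1)) : Finset ℕ) : Set ℕ) := by simp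
  obtain ⟨F, hF⟩ := hfin.exists_finset_coe
  rw [hFq, hcoe, ← hF, Set.ncard_coe_finset, Set.ncard_coe_finset,
    Finset.card_insert_of_notMem (by simp; omega), Nat.card_Icc] at hcard
  replace hmem (x : ℕ) : x ∈ F ↔ x < k ∧ Forbidden (Sk k) w (s + x) := by
    rw [← hmem s x, ← hF, Finset.mem_coe]
  rw [hFq, hcoe, ← hF, Finset.coe_inj]
  rcases hi1.eq_or_lt with rfl | hi
  · have hsub : F ⊆ insert 0 (Finset.Icc 1 (k - 1)) := by
      intro x hx
      have := ((hmem x).1 hx).1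
      simp only [Finset.mem_insert, Finset.mem_Icc]
      omega
    refine Finset.eq_of_subset_of_card_le hsub ?_
    rw [hcard, Finset.card_insert_of_notMem (by simp), Nat.card_Icc]
  have hst := hop.add_le_of_lt (by omega) hoq hcons.1
  have hfree : ¬ Forbidden (Sk k) w (t + i - k) :=
    not_forbidden_sub_of_occursAt_u hoq hi (by omega) (by omega)
      (hcons.2 _ (by omega) (by omega)).2 (by rw [hFt _ (by omega)]; omega)
  obtain ⟨c, n, hc, hn⟩ : ∃ c n, c < k ∧ s + (n + 1) * k = t + c := by
    have h := Nat.div_add_mod (t - s + k - 1) k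
    have hlt := Nat.mod_lt (t - s + k - 1) (by omega : 0 < k)
    have hpos : 1 ≤ (t - s + k - 1) / k := (Nat.one_le_div_iff (by omega)).2 (by omega)
    refine ⟨k - 1 - (t - s + k - 1) % k, (t - s + k - 1) / k - 1, by omega, ?_⟩
    rw [Nat.sub_add_cancel hpos, mul_comm]
    omega
  have hn' : s + n * k + k = t + c := by rw [← hn]; ring
  refine eq_insert_Icc_of_shift (c := c) hi1 (by omega) hc (fun x hx => ((hmem x).1 hx).1) ?_ ?_ ?_
  · intro h0
    exact (hmem _).2 ⟨by omega, Forbidden.add_of_occursAt_u (by omega) hop ((hmem 0).1 h0).2⟩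
  · omega
  · intro x hx hx0
    obtain ⟨hxk, hf⟩ := (hmem x).1 hx
    have hprop (m : ℕ) := hcons.forbidden_add_mul (by omega) hoq (j := s + x) (by omega) m
    rcases lt_or_ge (x + c) k with h | h
    · rw [Nat.mod_eq_of_lt h]
      have h1 := hprop (n + 1) (by omega) hf
      rw [show s + x + (n + 1) * k = t + (x + c) by omega, hFt _ h] at h1
      by_contra hcon
      apply hfree
      have h2 := hprop n (by omega) hf
      rwa [show s + x + n * k = t + i - k by omega] at h2
    · rw [Nat.mod_eq_sub_mod h, Nat.mod_eq_of_lt (by omega)]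
      have h1 := hprop n (by omega) hf
      rw [show s + x + n * k = t + (x + c - k) by omega, hFt _ (by omega)] at h1
      by_contra hcon
      apply hfree
      obtain _ | n := n
      · omega
      · rw [add_mul, one_mul] at hn'
        have h2 := hprop n (by omega) hf
        rwa [show s + x + n * k = t + i - k by omega] at h2

end Restivo
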